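/- arXiv:1802.01210 — 2 statements merged into one kernel-verified Lean document; each statement's English description precedes it below -/
import Mathlib

section
/- Let X be a hypersurface of degree d and dimension n in P^{n+1} over F_q containing no F_q-line (i.e. k_X ≤ 0). Then N_q(X) ≤ (d−1)·q^n + (d−2)·N_q(P^{n−1}) + 1. -/
/-- `NP q N` is the number of `F_q`-points of `P^N`, i.e. `q^N + q^(N-1) + … + q + 1`. -/
def NP (q N : ℕ) : ℕ := ∑ i ∈ Finset.range (N + 1), q ^ i

/-- `Theta q d n k` is the quantity `Θ_{n,k}^{d,q} = (d-1)·q^k·N_q(P^{n-k}) + N_q(P^k)`. -/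
def Theta (q d n k : ℕ) : ℕ := (d - 1) * q ^ k * NP q (n - k) + NP q k

/-- The number of `F`-rational points of the hypersurface `f = 0` in `P^{m-1}`. -/
noncomputable def numPoints {F : Type*} [Field F] {m : ℕ}
    (f : MvPolynomial (Fin m) F) : ℕ :=
  Nat.card {p : Projectivization F (Fin m → F) // MvPolynomial.eval p.rep f = 0}

/-- The projective linear subspace `P(W)` is contained in the hypersurface `f = 0`. -/
def SubInX {F : Type*} [Field F] {m : ℕ}
    (f : MvPolynomial (Fin m) F) (W : Submodule F (Fin m → F)) : Prop :=
  ∀ v ∈ W, MvPolynomial.eval v f = 0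

/-- The Thas invariant of the hypersurface `f = 0` equals `k`: there is an `F`-linear
projective subspace of dimension `k` contained in it, and none of dimension `k + 1`. -/
def ThasEq {F : Type*} [Field F] {m : ℕ}
    (f : MvPolynomial (Fin m) F) (k : ℕ) : Prop :=
  (∃ W : Submodule F (Fin m → F), Module.finrank F W = k + 1 ∧ SubInX f W) ∧
  ¬ ∃ W : Submodule F (Fin m → F), Module.finrank F W = k + 2 ∧ SubInX f W

/-- `v` is a homogeneous coordinate vector of a singular `F`-point of `f = 0`. -/
def IsSingPt {F : Type*} [Field F] {m : ℕ}
    (f : MvPolynomial (Fin m) F) (v : Fin m → F) : Prop :=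
  v ≠ 0 ∧ MvPolynomial.eval v f = 0 ∧
    ∀ i, MvPolynomial.eval v (MvPolynomial.pderiv i f) = 0
open MvPolynomial in
/-- Induction for homogeneous polynomials that keeps track of the degree. -/
theorem MvPolynomial.IsHomogeneous.induction_mul_X {σ R : Type*} [CommSemiring R]
    {P : ℕ → MvPolynomial σ R → Prop} (const : ∀ a, P 0 (C a)) (zero : ∀ d, P d 0)
    (add : ∀ d p q, P d p → P d q → P d (p + q)) (mul_X : ∀ d p i, P d p → P (d + 1) (p * X i))
    {d : ℕ} {f : MvPolynomial σ R} (hf : f.IsHomogeneous d) : P d f := by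
  have monomial_case : ∀ (s : σ →₀ ℕ) (a : R), P s.degree (monomial s a) := by
    intro s a
    induction s using Finsupp.induction with
    | zero => simpa using const a
    | single_add i e s _ _ ih =>
      have mul_pow : ∀ e : ℕ, P (e + s.degree) (monomial s a * X i ^ e) := by
        intro e
        induction e with
        | zero => simpa using ih
        | succ e he => simpa [pow_succ, mul_assoc, add_right_comm] using mul_X _ _ i he
      rw [map_add, Finsupp.degree_single, add_comm (Finsupp.single i e), monomial_add_single]
      exact mul_pow e
  rw [f.as_sum]
  refine Finset.sum_induction _ (P d) (add d) (zero d) fun s hs => ?_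
  have h := monomial_case s (coeff s f)
  rwa [Finsupp.degree_apply, ← hf.degree_eq_sum_deg_support hs] at h

theorem MvPolynomial.IsHomogeneous.eval_smul {σ R : Type*} [CommSemiring R] {d : ℕ}
    {f : MvPolynomial σ R} (hf : f.IsHomogeneous d) (c : R) (v : σ → R) :
    MvPolynomial.eval (c • v) f = c ^ d * MvPolynomial.eval v f := by
  refine hf.induction_mul_X
    (P := fun d f => MvPolynomial.eval (c • v) f = c ^ d * MvPolynomial.eval v f) ?_ ?_ ?_ ?_
  · simp
  · simp
  · intro d p q hp hq
    simp only [map_add, hp, hq, mul_add]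
  · intro d p i hp
    simp only [map_mul, MvPolynomial.eval_X, hp, Pi.smul_apply, smul_eq_mul]
    ring

/-- The restriction of `f` to the affine line `t ↦ h + t • v`. -/
noncomputable def linePoly {σ K : Type*} [CommSemiring K] (f : MvPolynomial σ K)
    (v h : σ → K) : Polynomial K :=
  MvPolynomial.aeval (fun i => Polynomial.C (h i) + Polynomial.X * Polynomial.C (v i)) f

theorem eval_linePoly {σ K : Type*} [CommSemiring K] (f : MvPolynomial σ K) (v h : σ → K)
    (t : K) : (linePoly f v h).eval t = MvPolynomial.eval (h + t • v) f := by
  induction f using MvPolynomial.induction_on with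
  | C a => simp [linePoly]
  | add p q hp hq => simp_all [linePoly]
  | mul_X p i hp => simp_all [linePoly, mul_comm t]

theorem natDegree_linePoly_le {σ K : Type*} [CommSemiring K] {d : ℕ} {f : MvPolynomial σ K}
    (hf : f.IsHomogeneous d) (v h : σ → K) : (linePoly f v h).natDegree ≤ d := by
  refine (MvPolynomial.aeval_natDegree_le f hf.totalDegree_le _ (n := 1) fun i => ?_).trans
    (mul_one d).le
  compute_degree

theorem coeff_linePoly {σ K : Type*} [CommSemiring K] {d : ℕ} {f : MvPolynomial σ K}
    (hf : f.IsHomogeneous d) (v h : σ → K) :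
    (linePoly f v h).coeff d = MvPolynomial.eval v f := by
  refine (hf.induction_mul_X (P := fun d f => (linePoly f v h).natDegree ≤ d ∧
    (linePoly f v h).coeff d = MvPolynomial.eval v f) ?_ ?_ ?_ ?_).2
  · simp [linePoly]
  · simp [linePoly]
  · rintro d p q ⟨hp, hp'⟩ ⟨hq, hq'⟩
    simp only [linePoly, map_add, Polynomial.coeff_add] at *
    exact ⟨Polynomial.natDegree_add_le_of_degree_le hp hq, by rw [hp', hq']⟩
  · rintro d p i ⟨hp, hp'⟩
    simp only [linePoly, map_mul, MvPolynomial.aeval_X, MvPolynomial.eval_X] at *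
    refine ⟨Polynomial.natDegree_mul_le_of_le hp (by compute_degree), ?_⟩
    simp only [mul_add, ← mul_assoc, Polynomial.coeff_add, Polynomial.coeff_mul_C,
      Polynomial.coeff_mul_X, hp', Polynomial.coeff_eq_zero_of_natDegree_lt (Nat.lt_succ_of_le hp)]
    simp

/-- The subleading coefficient of the restriction to `t ↦ h + t • v` is linear in `h`: it is
the differential of `f` at `v`. -/
theorem exists_linearMap_coeff_linePoly {σ K : Type*} [CommSemiring K] {d : ℕ}
    {f : MvPolynomial σ K} (hf : f.IsHomogeneous d) (v : σ → K) :
    ∃ L : (σ → K) →ₗ[K] K, ∀ h, (Polynomial.X * linePoly f v h).coeff d = L h := by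
  refine (hf.induction_mul_X (P := fun d f => f.IsHomogeneous d ∧
    ∃ L : (σ → K) →ₗ[K] K, ∀ h, (Polynomial.X * linePoly f v h).coeff d = L h) ?_ ?_ ?_ ?_).2
  · exact fun a => ⟨MvPolynomial.isHomogeneous_C _ a, 0, by simp⟩
  · exact fun d => ⟨MvPolynomial.isHomogeneous_zero _ _ d, 0, by simp [linePoly]⟩
  · rintro d p q ⟨hp, L, hL⟩ ⟨hq, M, hM⟩
    refine ⟨hp.add hq, L + M, fun h => ?_⟩
    rw [LinearMap.add_apply, ← hL, ← hM, ← Polynomial.coeff_add, ← mul_add]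
    simp only [linePoly, map_add]
  · rintro d p i ⟨hp, L, hL⟩
    refine ⟨hp.mul (MvPolynomial.isHomogeneous_X K i),
      MvPolynomial.eval v p • LinearMap.proj i + v i • L, fun h => ?_⟩
    have hmul : Polynomial.X * linePoly (p * MvPolynomial.X i) v h =
        Polynomial.X * (linePoly p v h * Polynomial.C (h i) +
          Polynomial.X * linePoly p v h * Polynomial.C (v i)) := by
      simp only [linePoly, map_mul, MvPolynomial.aeval_X]
      ring
    rw [hmul, Polynomial.coeff_X_mul, Polynomial.coeff_add, Polynomial.coeff_mul_C,
      Polynomial.coeff_mul_C, coeff_linePoly hp, hL]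
    simp [mul_comm]

theorem card_filter_add_smul_le {σ F : Type*} [Field F] [Fintype F] [DecidableEq F] {d : ℕ}
    (hd : 2 ≤ d) {f : MvPolynomial σ F} (hf : f.IsHomogeneous d) {v h : σ → F}
    (hv : MvPolynomial.eval v f = 0) (hne : linePoly f v h ≠ 0) :
    (Finset.univ.filter fun t : F => MvPolynomial.eval (h + t • v) f = 0).card ≤
      (d - 2) + if (Polynomial.X * linePoly f v h).coeff d = 0 then 0 else 1 := by
  have hroots : (Finset.univ.filter fun t : F => MvPolynomial.eval (h + t • v) f = 0).card ≤
      (linePoly f v h).natDegree := by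
    refine Polynomial.card_le_degree_of_subset_roots fun t ht => ?_
    simpa [hne, eval_linePoly] using ht
  refine hroots.trans ?_
  have hle := natDegree_linePoly_le hf v h
  have hlead := Polynomial.leadingCoeff_ne_zero.2 hne
  have hne_d : (linePoly f v h).natDegree ≠ d := by
    intro heq
    rw [Polynomial.leadingCoeff, heq, coeff_linePoly hf] at hlead
    exact hlead hv
  split_ifs with hcoeff
  · have : (linePoly f v h).natDegree ≠ d - 1 := by
      intro heq
      obtain ⟨e, rfl⟩ : ∃ e, d = e + 1 := ⟨d - 1, by omega⟩
      rw [Polynomial.coeff_X_mul] at hcoeff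
      rw [Polynomial.leadingCoeff, heq] at hlead
      exact hlead hcoeff
    omega
  · omega

theorem subInX_span_pair {F : Type*} [Field F] {m d : ℕ} {f : MvPolynomial (Fin m) F}
    (hf : f.IsHomogeneous d) {v h : Fin m → F} (hv : MvPolynomial.eval v f = 0)
    (hline : linePoly f v h = 0) : SubInX f (Submodule.span F {v, h}) := by
  intro w hw
  obtain ⟨a, b, rfl⟩ := Submodule.mem_span_pair.1 hw
  by_cases hb : b = 0
  · simp [hb, hf.eval_smul, hv]
  · have : a • v + b • h = b • (h + (b⁻¹ * a) • v) := by
      rw [smul_add, smul_smul, mul_inv_cancel_left₀ hb, add_comm]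
    rw [this, hf.eval_smul, ← eval_linePoly, hline]
    simp

theorem linePoly_ne_zero {F : Type*} [Field F] {m d : ℕ} {f : MvPolynomial (Fin m) F}
    (hf : f.IsHomogeneous d)
    (hline : ¬ ∃ W : Submodule F (Fin m → F), Module.finrank F W = 2 ∧ SubInX f W)
    {v h : Fin m → F} (hv0 : v ≠ 0) (hv : MvPolynomial.eval v f = 0)
    (hh : h ∉ Submodule.span F {v}) : linePoly f v h ≠ 0 := by
  intro hzero
  refine hline ⟨_, ?_, subInX_span_pair hf hv hzero⟩
  have hind : LinearIndependent F ![v, h] :=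
    (LinearIndependent.pair_iff' hv0).2 fun a ha => hh (Submodule.mem_span_singleton.2 ⟨a, ha⟩)
  have hfinrank := finrank_span_eq_card hind
  rwa [Matrix.range_cons, Matrix.range_cons, Matrix.range_empty, Set.union_empty,
    Set.singleton_union, Fintype.card_fin] at hfinrank

/-- The affine cone over the rational points has at least `(q - 1) * N + 1` elements. -/
theorem numPoints_mul_add_one_le {F : Type*} [Field F] [Fintype F] [DecidableEq F] {m d : ℕ}
    {f : MvPolynomial (Fin m) F} (hf : f.IsHomogeneous d) (hd : d ≠ 0) :
    numPoints f * (Fintype.card F - 1) + 1 ≤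
      (Finset.univ.filter fun w : Fin m → F => MvPolynomial.eval w f = 0).card := by
  classical
  let φ : {p : Projectivization F (Fin m → F) // MvPolynomial.eval p.rep f = 0} × Fˣ →
      {w : Fin m → F // w ∈ (Finset.univ.filter
        fun w : Fin m → F => MvPolynomial.eval w f = 0).erase 0} :=
    fun x => ⟨(x.2 : F) • x.1.1.rep, by
      simp [hf.eval_smul, x.1.2, x.1.1.rep_nonzero]⟩
  have hφ : Function.Injective φ := by
    rintro ⟨⟨p, hp⟩, a⟩ ⟨⟨p', hp'⟩, b⟩ hab
    have heq : (a : F) • p.rep = (b : F) • p'.rep := congrArg Subtype.val hab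
    obtain rfl : p = p' := by
      rw [← p.mk_rep, ← p'.mk_rep, Projectivization.mk_eq_mk_iff']
      exact ⟨(a : F)⁻¹ * b, by
        rw [← smul_smul, ← heq, smul_smul, inv_mul_cancel₀ a.ne_zero, one_smul]⟩
    simpa using Units.ext (smul_left_injective F p.rep_nonzero heq)
  have hcard := Nat.card_le_card_of_injective φ hφ
  have hzero : (0 : Fin m → F) ∈
      Finset.univ.filter fun w : Fin m → F => MvPolynomial.eval w f = 0 := by
    simpa [hd] using hf.eval_smul 0 0
  rw [Nat.card_prod, Nat.card_eq_fintype_card (α := Fˣ), Fintype.card_units,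
    Nat.subtype_card _ fun _ => Iff.rfl, Finset.card_erase_of_mem hzero] at hcard
  have := Finset.card_pos.2 ⟨_, hzero⟩
  unfold numPoints
  omega

theorem pow_le_card_filter_eq_zero {F : Type*} [Field F] [Fintype F] [DecidableEq F] {m : ℕ}
    (L : (Fin (m + 1) → F) →ₗ[F] F) :
    Fintype.card F ^ m ≤ (Finset.univ.filter fun h => L h = 0).card := by
  classical
  have hker : (Finset.univ.filter fun h => L h = 0).card =
      Fintype.card F ^ Module.finrank F (LinearMap.ker L) := by
    rw [← Fintype.card_subtype, ← Module.card_eq_pow_finrank (K := F) (V := LinearMap.ker L)]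
    exact Fintype.card_congr (Equiv.refl _)
  rw [hker]
  refine Nat.pow_le_pow_right Fintype.card_pos ?_
  have hrank := L.finrank_range_add_finrank_ker
  have hrange := (LinearMap.range L).finrank_le
  simp at hrank hrange
  omega

/-- Counting the pairs `(h, t)` with `f (h + t • v) = 0` in two ways. -/
theorem card_mul_card_filter_eq_sum {σ F : Type*} [Fintype σ] [DecidableEq σ] [Field F]
    [Fintype F] [DecidableEq F] (f : MvPolynomial σ F) (v : σ → F) :
    Fintype.card F * (Finset.univ.filter fun w => MvPolynomial.eval w f = 0).card =
      ∑ h, (Finset.univ.filter fun t : F => MvPolynomial.eval (h + t • v) f = 0).card := by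
  simp only [Finset.card_filter]
  rw [Finset.sum_comm, eq_comm]
  have htranslate (t : F) := Equiv.sum_comp (Equiv.addRight (t • v))
    fun w => if MvPolynomial.eval w f = 0 then 1 else 0
  exact (Finset.sum_congr rfl fun t _ => htranslate t).trans (by simp)

theorem card_mul_card_zeros_le {F : Type*} [Field F] [Fintype F] [DecidableEq F] {m d : ℕ}
    (hd : 2 ≤ d) {f : MvPolynomial (Fin (m + 1)) F} (hf : f.IsHomogeneous d)
    (hline : ¬ ∃ W : Submodule F (Fin (m + 1) → F), Module.finrank F W = 2 ∧ SubInX f W)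
    {v : Fin (m + 1) → F} (hv0 : v ≠ 0) (hv : MvPolynomial.eval v f = 0) :
    Fintype.card F * (Finset.univ.filter fun w => MvPolynomial.eval w f = 0).card +
        ((d - 2) * Fintype.card F + Fintype.card F ^ m) ≤
      Fintype.card F ^ 2 + (d - 1) * Fintype.card F ^ (m + 1) := by
  classical
  obtain ⟨L, hL⟩ := exists_linearMap_coeff_linePoly hf v
  have hspan : (Finset.univ.filter fun h => h ∈ Submodule.span F {v}).card = Fintype.card F := by
    rw [← Fintype.card_subtype]
    have := Module.card_eq_pow_finrank (K := F) (V := Submodule.span F {v})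
    rwa [finrank_span_singleton hv0, pow_one] at this
  have hbound : ∀ h, (Finset.univ.filter fun t : F => MvPolynomial.eval (h + t • v) f = 0).card +
      ((if h ∈ Submodule.span F {v} then d - 2 else 0) + if L h = 0 then 1 else 0) ≤
      (if h ∈ Submodule.span F {v} then Fintype.card F else 0) + (d - 1) := by
    intro h
    by_cases hh : h ∈ Submodule.span F {v}
    · have := Finset.card_le_univ
        (Finset.univ.filter fun t : F => MvPolynomial.eval (h + t • v) f = 0)
      simp only [hh, if_true]
      split_ifs <;> omega
    · have := card_filter_add_smul_le hd hf hv (linePoly_ne_zero hf hline hv0 hv hh)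
      rw [hL] at this
      simp only [hh, if_false]
      split_ifs at this ⊢ <;> omega
  have hsum := Finset.sum_le_sum fun h (_ : h ∈ Finset.univ) => hbound h
  simp only [Finset.sum_add_distrib, ← Finset.sum_filter, Finset.sum_const, smul_eq_mul, hspan,
    ← card_mul_card_filter_eq_sum, Finset.card_univ, Fintype.card_pi_const, mul_one] at hsum
  have := pow_le_card_filter_eq_zero L
  nlinarith

theorem stmt1 {F : Type*} [Field F] [Fintype F] {n d : ℕ}
    (hn : 1 ≤ n) (hd : 2 ≤ d)
    (f : MvPolynomial (Fin (n + 2)) F) (hf0 : f ≠ 0) (hsq : Squarefree f)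
    (hhom : f.IsHomogeneous d)
    (hline : ¬ ∃ W : Submodule F (Fin (n + 2) → F), Module.finrank F W = 2 ∧ SubInX f W) :
    numPoints f ≤
      (d - 1) * Fintype.card F ^ n + (d - 2) * NP (Fintype.card F) (n - 1) + 1 := by
  classical
  by_cases hempty : IsEmpty
      {p : Projectivization F (Fin (n + 2) → F) // MvPolynomial.eval p.rep f = 0}
  · simp [numPoints]
  obtain ⟨p, hp⟩ := not_isEmpty_iff.1 hempty
  have hcount := card_mul_card_zeros_le hd hhom hline p.rep_nonzero hp
  have hcone := numPoints_mul_add_one_le hhom (by omega)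
  obtain ⟨e, rfl⟩ := Nat.exists_eq_add_of_le hd
  have hq := Fintype.one_lt_card (α := F)
  have hgeom : NP (Fintype.card F) (n - 1) * (Fintype.card F - 1) + 1 = Fintype.card F ^ n := by
    rw [NP, Nat.sub_add_cancel hn]
    have := geom_sum_mul_add (Fintype.card F - 1) n
    rwa [Nat.sub_add_cancel hq.le] at this
  rw [pow_succ _ (n + 1), pow_succ _ n, ← hgeom] at hcount
  rw [← hgeom]
  obtain ⟨r, hr⟩ := Nat.exists_eq_add_of_le' hq.le
  rw [hr] at hcount hcone hq ⊢
  simp only [Nat.add_sub_cancel, show 2 + e - 2 = e by omega,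
    show 2 + e - 1 = e + 1 by omega] at hcount hcone ⊢
  have hscaled := Nat.mul_le_mul_left (r + 1) hcone
  have hr0 : 0 < r := by omega
  refine Nat.le_of_mul_le_mul_right (c := r * (r + 1)) ?_ (by positivity)
  linarith
end

section
/- Let X be a hypersurface of degree d and dimension n in P^{n+1} over F_q containing no F_q-line (i.e. k_X ≤ 0). If X has a singular F_q-point, then N_q(X) ≤ (d−2)·q^n + (d−2)·N_q(P^{n−1}) + 1. -/
open MvPolynomial in
/-- Reversing the two homogeneous coordinates of a line reflects the restriction of a form to it. -/
theorem MvPolynomial.IsHomogeneous.natDegree_aeval_line_le_and_reflect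
    {F σ : Type*} [Field F] {d : ℕ} {f : MvPolynomial σ F} (hf : f.IsHomogeneous d) (v w : σ → F) :
    (MvPolynomial.aeval (fun i ↦ Polynomial.C (v i) + Polynomial.X * Polynomial.C (w i)) f).natDegree ≤ d ∧
    (MvPolynomial.aeval (fun i ↦ Polynomial.C (v i) + Polynomial.X * Polynomial.C (w i)) f).reflect d =
      MvPolynomial.aeval (fun i ↦ Polynomial.C (w i) + Polynomial.X * Polynomial.C (v i)) f := by
  have hlin (a b : F) :
      (Polynomial.C a + Polynomial.X * Polynomial.C b).natDegree ≤ 1 ∧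
      (Polynomial.C a + Polynomial.X * Polynomial.C b).reflect 1 =
        Polynomial.C b + Polynomial.X * Polynomial.C a := by
    refine ⟨by compute_degree, ?_⟩
    rw [Polynomial.reflect_add, Polynomial.reflect_C, mul_comm Polynomial.X,
      Polynomial.reflect_C_mul, Polynomial.reflect_one_X]
    ring
  have hpow (a b : F) (k : ℕ) :
      ((Polynomial.C a + Polynomial.X * Polynomial.C b) ^ k).natDegree ≤ k ∧
      ((Polynomial.C a + Polynomial.X * Polynomial.C b) ^ k).reflect k =
        (Polynomial.C b + Polynomial.X * Polynomial.C a) ^ k := by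
    induction k with
    | zero => simp [Polynomial.reflect_one]
    | succ k ih =>
      rw [pow_succ, pow_succ]
      exact ⟨Polynomial.natDegree_mul_le_of_le ih.1 (hlin a b).1, by
        rw [Polynomial.reflect_mul _ _ ih.1 (hlin a b).1, ih.2, (hlin a b).2]⟩
  have hmon (e : σ →₀ ℕ) :
      (e.prod fun i k ↦ (Polynomial.C (v i) + Polynomial.X * Polynomial.C (w i)) ^ k).natDegree
        ≤ e.degree ∧
      (e.prod fun i k ↦
          (Polynomial.C (v i) + Polynomial.X * Polynomial.C (w i)) ^ k).reflect e.degree =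
        e.prod fun i k ↦ (Polynomial.C (w i) + Polynomial.X * Polynomial.C (v i)) ^ k := by
    induction e using Finsupp.induction_linear with
    | zero => simp [Polynomial.reflect_one]
    | add e₁ e₂ h₁ h₂ =>
      rw [Finsupp.prod_add_index' (by simp) (fun _ _ _ ↦ pow_add _ _ _),
        Finsupp.prod_add_index' (by simp) (fun _ _ _ ↦ pow_add _ _ _), map_add]
      exact ⟨Polynomial.natDegree_mul_le_of_le h₁.1 h₂.1, by
        rw [Polynomial.reflect_mul _ _ h₁.1 h₂.1, h₁.2, h₂.2]⟩
    | single i k => simpa using hpow (v i) (w i) k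
  have hdeg {e : σ →₀ ℕ} (he : e ∈ f.support) : e.degree = d := by
    rw [Finsupp.degree_eq_weight_one]
    exact hf (mem_support_iff.mp he)
  rw [aeval_def, aeval_def, eval₂_eq, eval₂_eq]
  constructor
  · refine Polynomial.natDegree_sum_le_of_forall_le _ _ fun e he ↦ ?_
    exact (Polynomial.natDegree_C_mul_le _ _).trans ((hmon e).1.trans (hdeg he).le)
  · ext k
    simp only [Polynomial.coeff_reflect, Polynomial.finsetSum_coeff, Polynomial.algebraMap_eq,
      Polynomial.coeff_C_mul]
    refine Finset.sum_congr rfl fun e he ↦ ?_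
    have := congrArg (fun p ↦ p.coeff k) (hmon e).2
    simp only [Polynomial.coeff_reflect, hdeg he] at this
    exact congrArg _ this

open MvPolynomial in
/-- The chain rule for substituting univariate polynomials. -/
theorem MvPolynomial.derivative_aeval {F σ : Type*} [CommRing F] [Fintype σ]
    (f : MvPolynomial σ F) (p : σ → Polynomial F) :
    Polynomial.derivative (aeval p f) =
      ∑ i, aeval p (pderiv i f) * Polynomial.derivative (p i) := by
  classical
  induction f using MvPolynomial.induction_on with
  | C a => simp
  | add f g hf hg => simp [hf, hg, add_mul, Finset.sum_add_distrib]
  | mul_X f j hf =>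
    simp only [map_mul, aeval_X, Polynomial.derivative_mul, hf, Derivation.leibniz, pderiv_X,
      smul_eq_mul, map_add, add_mul, Finset.sum_add_distrib]
    rw [add_comm]
    congr 1
    · simp [Pi.single_apply, apply_ite]
    · rw [Finset.sum_mul]
      exact Finset.sum_congr rfl fun _ _ ↦ by ring

open MvPolynomial in
theorem MvPolynomial.eval_aeval_line {F σ : Type*} [CommRing F]
    (f : MvPolynomial σ F) (v w : σ → F) (t : F) :
    (aeval (fun i ↦ Polynomial.C (w i) + Polynomial.X * Polynomial.C (v i)) f).eval t =
      eval (w + t • v) f := by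
  induction f using MvPolynomial.induction_on with
  | C a => simp
  | add f g hf hg => rw [map_add, Polynomial.eval_add, hf, hg, map_add]
  | mul_X f j hf =>
    rw [map_mul, Polynomial.eval_mul, hf, map_mul, aeval_X, eval_X]
    simp [mul_comm t]

open MvPolynomial in
theorem IsSingPt.natDegree_aeval_line_le {F : Type*} [Field F] {m d : ℕ}
    {f : MvPolynomial (Fin m) F} (hhom : f.IsHomogeneous d) {v : Fin m → F}
    (hv : IsSingPt f v) (w : Fin m → F) :
    (aeval (fun i ↦ Polynomial.C (w i) + Polynomial.X * Polynomial.C (v i)) f).natDegree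
      ≤ d - 2 := by
  obtain ⟨hdeg, -⟩ := hhom.natDegree_aeval_line_le_and_reflect w v
  obtain ⟨-, hrefl⟩ := hhom.natDegree_aeval_line_le_and_reflect v w
  set h := aeval (fun i ↦ Polynomial.C (v i) + Polynomial.X * Polynomial.C (w i)) f with hh
  have h0 : h.coeff 0 = 0 := by
    rw [Polynomial.coeff_zero_eq_eval_zero, hh, eval_aeval_line]
    simpa using hv.2.1
  have h1 : h.coeff 1 = 0 := by
    have : (Polynomial.derivative h).eval 0 = 0 := by
      rw [hh, derivative_aeval, Polynomial.eval_finsetSum]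
      refine Finset.sum_eq_zero fun i _ ↦ ?_
      rw [Polynomial.eval_mul, eval_aeval_line]
      simp [hv.2.2 i]
    rw [← Polynomial.coeff_zero_eq_eval_zero, Polynomial.coeff_derivative] at this
    simpa using this
  rw [Polynomial.natDegree_le_iff_coeff_eq_zero]
  intro k hk
  by_cases hkd : k ≤ d
  · rw [← hrefl, Polynomial.coeff_reflect, Polynomial.revAt_le hkd]
    obtain h | h : d - k = 0 ∨ d - k = 1 := by omega
    · rw [h, h0]
    · rw [h, h1]
  · exact Polynomial.coeff_eq_zero_of_natDegree_lt (by omega)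

theorem MvPolynomial.IsHomogeneous.eval_smul_eq {F σ : Type*} [Field F] {d : ℕ}
    {f : MvPolynomial σ F} (hf : f.IsHomogeneous d) (a : F) (x : σ → F) :
    MvPolynomial.eval (a • x) f = a ^ d * MvPolynomial.eval x f := by
  rw [MvPolynomial.eval_eq, MvPolynomial.eval_eq, Finset.mul_sum]
  refine Finset.sum_congr rfl fun e he ↦ ?_
  have hd : ∑ i ∈ e.support, e i = d := by
    rw [← Finsupp.degree_apply, Finsupp.degree_eq_weight_one]
    exact hf (MvPolynomial.mem_support_iff.mp he)
  simp only [Pi.smul_apply, smul_eq_mul, mul_pow, Finset.prod_mul_distrib,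
    Finset.prod_pow_eq_pow_sum, hd]
  ring

/-- A line through a singular point and not contained in the hypersurface meets it in at most
`d - 2` further points. -/
theorem IsSingPt.exists_finset_line {F : Type*} [Field F] {m d : ℕ}
    {f : MvPolynomial (Fin m) F} (hhom : f.IsHomogeneous d)
    (hline : ¬ ∃ W : Submodule F (Fin m → F), Module.finrank F W = 2 ∧ SubInX f W)
    {v : Fin m → F} (hv : IsSingPt f v) {w : Fin m → F} (hw : w ∉ Submodule.span F {v}) :
    ∃ s : Finset F, s.card ≤ d - 2 ∧ ∀ t, MvPolynomial.eval (w + t • v) f = 0 → t ∈ s := by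
  classical
  set g := MvPolynomial.aeval
    (fun i ↦ Polynomial.C (w i) + Polynomial.X * Polynomial.C (v i)) f with hg
  have hg0 : g ≠ 0 := by
    intro h0
    have hzero (t : F) : MvPolynomial.eval (w + t • v) f = 0 := by
      rw [← MvPolynomial.eval_aeval_line, ← hg, h0, Polynomial.eval_zero]
    refine hline ⟨Submodule.span F {v, w}, ?_, ?_⟩
    · have hli : LinearIndependent F ![v, w] := by
        rw [LinearIndependent.pair_iff' hv.1]
        intro a ha
        exact hw (Submodule.mem_span_singleton.mpr ⟨a, ha⟩)
      have := finrank_span_eq_card hli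
      rwa [Matrix.range_cons, Matrix.range_cons, Matrix.range_empty, Set.union_empty,
        Set.singleton_union, Fintype.card_fin] at this
    · intro x hx
      obtain ⟨a, b, rfl⟩ := Submodule.mem_span_pair.mp hx
      by_cases hb : b = 0
      · rw [hb, zero_smul, add_zero, hhom.eval_smul_eq, hv.2.1, mul_zero]
      · have : a • v + b • w = b • (w + (b⁻¹ * a) • v) := by
          rw [smul_add, smul_smul, mul_inv_cancel_left₀ hb, add_comm]
        rw [this, hhom.eval_smul_eq, hzero, mul_zero]
  refine ⟨g.roots.toFinset, ?_, fun t ht ↦ ?_⟩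
  · exact (Multiset.toFinset_card_le _).trans
      ((Polynomial.card_roots' g).trans (hv.natDegree_aeval_line_le hhom w))
  · rw [Multiset.mem_toFinset, Polynomial.mem_roots hg0, Polynomial.IsRoot.def, hg,
      MvPolynomial.eval_aeval_line, ht]

theorem NP_eq_pow_add {q n : ℕ} (hn : 1 ≤ n) : NP q n = q ^ n + NP q (n - 1) := by
  rw [NP, Finset.sum_range_succ, NP, Nat.sub_add_cancel hn, add_comm]

/-- Projecting away from a singular point bounds the number of rational points. -/
theorem IsSingPt.numPoints_le {F : Type*} [Field F] [Finite F] {n d : ℕ}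
    {f : MvPolynomial (Fin (n + 2)) F} (hhom : f.IsHomogeneous d)
    (hline : ¬ ∃ W : Submodule F (Fin (n + 2) → F), Module.finrank F W = 2 ∧ SubInX f W)
    {v : Fin (n + 2) → F} (hv : IsSingPt f v) :
    numPoints f ≤ (d - 2) * NP (Nat.card F) n + 1 := by
  classical
  set L := Submodule.span F {v} with hL
  let Q := (Fin (n + 2) → F) ⧸ L
  have hQ : Module.finrank F Q = n + 1 := by
    have := Submodule.finrank_quotient_add_finrank L
    rw [finrank_span_singleton hv.1, Module.finrank_fin_fun] at this
    exact Nat.add_right_cancel this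
  let _ : Fintype (Projectivization F (Fin (n + 2) → F)) := Fintype.ofFinite _
  have : Finite Q := Finite.of_surjective _ L.mkQ_surjective
  let _ : Fintype (Projectivization F Q) := Fintype.ofFinite _
  have hcard : Fintype.card (Projectivization F Q) = NP (Nat.card F) n := by
    rw [← Nat.card_eq_fintype_card, Projectivization.card_of_finrank F Q hQ, NP]
  let A : Finset (Projectivization F (Fin (n + 2) → F)) :=
    {p | MvPolynomial.eval p.rep f = 0}
  let p₀ := Projectivization.mk F v hv.1
  have hrep {p : Projectivization F (Fin (n + 2) → F)} (hp : p ∈ A.erase p₀) : p.rep ∉ L := by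
    intro h
    obtain ⟨a, ha⟩ := Submodule.mem_span_singleton.mp h
    refine (Finset.mem_erase.mp hp).1 ?_
    rw [← p.mk_rep, Projectivization.mk_eq_mk_iff']
    exact ⟨a, ha⟩
  have hne {p : Projectivization F (Fin (n + 2) → F)} (hp : p ∈ A.erase p₀) :
      L.mkQ p.rep ≠ 0 := by
    simpa [Submodule.Quotient.mk_eq_zero] using hrep hp
  have : Nonempty (Projectivization F Q) := by
    rw [← Fintype.card_pos_iff, hcard, NP, Finset.sum_range_succ']
    simp
  let φ (p : Projectivization F (Fin (n + 2) → F)) : Projectivization F Q :=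
    if h : L.mkQ p.rep ≠ 0 then Projectivization.mk F _ h else Classical.arbitrary _
  have hfib (l : Projectivization F Q) : ((A.erase p₀).filter (φ · = l)).card ≤ d - 2 := by
    obtain ⟨w, hw⟩ := L.mkQ_surjective l.rep
    have hwL : w ∉ L := by
      intro h
      refine l.rep_nonzero ?_
      rw [← hw]
      exact (Submodule.Quotient.mk_eq_zero L).mpr h
    obtain ⟨s, hs, hmem⟩ := hv.exists_finset_line hhom hline hwL
    have hpar : ∀ p ∈ (A.erase p₀).filter (φ · = l),
        ∃ t : F, ∃ a : F, a ≠ 0 ∧ a • p.rep = w + t • v := by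
      intro p hp
      obtain ⟨hpA, hpl⟩ := Finset.mem_filter.mp hp
      simp only [φ, dif_pos (hne hpA)] at hpl
      rw [← l.mk_rep, Projectivization.mk_eq_mk_iff'] at hpl
      obtain ⟨b, hb⟩ := hpl
      have hb0 : b ≠ 0 := by
        rintro rfl
        exact hne hpA (by rw [← hb, zero_smul])
      rw [← hw, ← map_smul, eq_comm, ← sub_eq_zero, ← map_sub, Submodule.mkQ_apply,
        Submodule.Quotient.mk_eq_zero] at hb
      obtain ⟨c, hc⟩ := Submodule.mem_span_singleton.mp hb
      refine ⟨b⁻¹ * c, b⁻¹, inv_ne_zero hb0, ?_⟩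
      rw [mul_smul, hc, smul_sub, inv_smul_smul₀ hb0]
      abel
    choose! t a ha hta using hpar
    refine (Finset.card_le_card_of_injOn t (fun p hp ↦ hmem _ ?_) ?_).trans hs
    · have hpA := (Finset.mem_filter.mp (Finset.mem_erase.mp (Finset.mem_filter.mp hp).1).2).2
      rw [← hta p hp, hhom.eval_smul_eq, hpA, mul_zero]
    · intro p hp p' hp' h
      have heq : a p • p.rep = a p' • p'.rep := by rw [hta p hp, hta p' hp', h]
      rw [← p.mk_rep, ← p'.mk_rep, Projectivization.mk_eq_mk_iff']
      exact ⟨(a p)⁻¹ * a p', by rw [mul_smul, ← heq, inv_smul_smul₀ (ha p hp)]⟩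
  have hA : (A.erase p₀).card ≤ (d - 2) * NP (Nat.card F) n := by
    rw [← hcard, ← Finset.card_univ]
    exact Finset.card_le_mul_card_image_of_maps_to (f := φ) (fun _ _ ↦ Finset.mem_univ _) _
      fun l _ ↦ hfib l
  calc numPoints f = A.card := by rw [numPoints, Nat.card_eq_fintype_card, Fintype.card_subtype]
    _ ≤ (A.erase p₀).card + 1 := by
      have := Finset.pred_card_le_card_erase (s := A) (a := p₀)
      omega
    _ ≤ _ := Nat.add_le_add_right hA 1

theorem stmt2 {F : Type*} [Field F] [Fintype F] {n d : ℕ}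
    (hn : 1 ≤ n) (hd : 2 ≤ d)
    (f : MvPolynomial (Fin (n + 2)) F) (hf0 : f ≠ 0) (hsq : Squarefree f)
    (hhom : f.IsHomogeneous d)
    (hline : ¬ ∃ W : Submodule F (Fin (n + 2) → F), Module.finrank F W = 2 ∧ SubInX f W)
    (hsing : ∃ v : Fin (n + 2) → F, IsSingPt f v) :
    numPoints f ≤
      (d - 2) * Fintype.card F ^ n + (d - 2) * NP (Fintype.card F) (n - 1) + 1 := by
  obtain ⟨v, hv⟩ := hsing
  rw [← mul_add, ← NP_eq_pow_add hn, ← Nat.card_eq_fintype_card]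
  exact hv.numPoints_le hhom hline
end
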